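/- Let (σ_AB^{(n)})_{n∈ℕ} be a sequence of bipartite density matrices on ℂ^{d_A} ⊗ ℂ^{d_B} converging (entrywise) to a density matrix ρ_AB, and suppose lim_{n→∞} μ(σ_AB^{(n)}) = λ. Then μ(ρ_AB) ≤ λ. In particular, if λ = 0 then ρ_AB is a product state ρ_A ⊗ ρ_B. -/

import Mathlib

open scoped Matrix Kronecker ComplexOrder
open Matrix

noncomputable section

/-- Partial trace over the second (B) system. -/
def ptrB {A B : Type*} [Fintype B] (ρ : Matrix (A × B) (A × B) ℂ) : Matrix A A ℂ :=
  fun i j => ∑ k, ρ (i, k) (j, k)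

/-- Partial trace over the first (A) system. -/
def ptrA {A B : Type*} [Fintype A] (ρ : Matrix (A × B) (A × B) ℂ) : Matrix B B ℂ :=
  fun k l => ∑ i, ρ (i, k) (i, l)

/-- A density matrix: positive semidefinite with trace one. -/
def IsDensity {n : Type*} [Fintype n] (ρ : Matrix n n ℂ) : Prop :=
  ρ.PosSemidef ∧ ρ.trace = 1

/-- Maximal correlation of a bipartite state. -/
def mu {A B : Type*} [Fintype A] [Fintype B] (ρ : Matrix (A × B) (A × B) ℂ) : ℝ :=
  sSup {r : ℝ | ∃ (X : Matrix A A ℂ) (Y : Matrix B B ℂ),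
    ((ptrB ρ) * X).trace = 0 ∧ ((ptrA ρ) * Y).trace = 0 ∧
    ((ptrB ρ) * (X * Xᴴ)).trace = 1 ∧ ((ptrA ρ) * (Y * Yᴴ)).trace = 1 ∧
    r = ‖(ρ * (X ⊗ₖ Yᴴ)).trace‖}

/-- Maximal entanglement: infimum over finite decompositions of the max correlation. -/
def muEnt {A B : Type*} [Fintype A] [Fintype B] (ρ : Matrix (A × B) (A × B) ℂ) : ℝ :=
  sInf {r : ℝ | ∃ (m : ℕ) (p : Fin m → ℝ) (τ : Fin m → Matrix (A × B) (A × B) ℂ),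
    (∀ i, 0 ≤ p i) ∧ (∑ i, p i) = 1 ∧ (∀ i, IsDensity (τ i)) ∧
    ρ = ∑ i, p i • τ i ∧ r = ⨆ i, mu (τ i)}

/-- Application of a product channel given by local Kraus operators. -/
def applyLocal {A B A' B' ι κ : Type*} [Fintype A] [Fintype B] [Fintype ι] [Fintype κ]
    (K : ι → Matrix A' A ℂ) (L : κ → Matrix B' B ℂ)
    (ρ : Matrix (A × B) (A × B) ℂ) : Matrix (A' × B') (A' × B') ℂ :=
  ∑ k, ∑ m, (K k ⊗ₖ L m) * ρ * (K k ⊗ₖ L m)ᴴ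

/-- Tensor product of two bipartite states, with the A-systems grouped together. -/
def prodState {A B A' B' : Type*}
    (ρ : Matrix (A × B) (A × B) ℂ) (σ : Matrix (A' × B') (A' × B') ℂ) :
    Matrix ((A × A') × (B × B')) ((A × A') × (B × B')) ℂ :=
  fun x y => ρ (x.1.1, x.2.1) (y.1.1, y.2.1) * σ (x.1.2, x.2.2) (y.1.2, y.2.2)

/-- n-fold tensor power of a bipartite state, with all A-systems grouped together. -/
def powState {A B : Type*} (ρ : Matrix (A × B) (A × B) ℂ) (n : ℕ) :
    Matrix ((Fin n → A) × (Fin n → B)) ((Fin n → A) × (Fin n → B)) ℂ :=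
  fun x y => ∏ i, ρ (x.1 i, x.2 i) (y.1 i, y.2 i)

/-- The two-qubit Bell vector (|00⟩+|11⟩)/√2. -/
def bellVec : Fin 2 × Fin 2 → ℂ := fun p => if p.1 = p.2 then 1 / (Real.sqrt 2 : ℂ) else 0

/-- Inverse of the positive semidefinite square root. -/
def invSqrt {n : Type*} [Fintype n] [DecidableEq n] (M : Matrix n n ℂ) : Matrix n n ℂ :=
  letI := Classical.dec M.PosSemidef
  if h : M.PosSemidef then
    (h.1.eigenvectorUnitary.1 * diagonal (RCLike.ofReal ∘ Real.sqrt ∘ h.1.eigenvalues) *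
      (star h.1.eigenvectorUnitary : Matrix n n ℂ))⁻¹
  else 0


section MaximalCorrelation

variable {A B : Type*} [Fintype A] [Fintype B]

lemma trace_ptrB_mul [DecidableEq B] (ρ : Matrix (A × B) (A × B) ℂ) (X : Matrix A A ℂ) :
    (ptrB ρ * X).trace = (ρ * (X ⊗ₖ (1 : Matrix B B ℂ))).trace := by
  simp only [trace, diag, mul_apply, ptrB, kroneckerMap_apply, Fintype.sum_prod_type, one_apply,
    mul_ite, mul_one, mul_zero, Finset.sum_ite_eq', Finset.mem_univ, if_true, Finset.sum_mul]
  exact Finset.sum_congr rfl fun _ _ => Finset.sum_comm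

lemma trace_ptrA_mul [DecidableEq A] (ρ : Matrix (A × B) (A × B) ℂ) (Y : Matrix B B ℂ) :
    (ptrA ρ * Y).trace = (ρ * ((1 : Matrix A A ℂ) ⊗ₖ Y)).trace := by
  have h (i j : A) (k l : B) : ρ (i, k) (j, l) * ((if j = i then 1 else 0) * Y l k)
      = if j = i then ρ (i, k) (j, l) * Y l k else 0 := by
    split_ifs <;> simp
  simp only [trace, diag, mul_apply, ptrA, kroneckerMap_apply, Fintype.sum_prod_type, one_apply,
    Finset.sum_mul, h]
  rw [Finset.sum_comm (s := (Finset.univ : Finset A))]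
  refine Finset.sum_congr rfl fun k _ => ?_
  rw [Finset.sum_comm]
  refine Finset.sum_congr rfl fun i _ => ?_
  rw [Finset.sum_comm]
  simp

/-- The Cauchy–Schwarz inequality for the sesquilinear form `(P, Q) ↦ tr (M P Qᴴ)`. -/
lemma norm_trace_mul_conjTranspose_le {n : Type*} [Fintype n] {M : Matrix n n ℂ}
    (hM : M.PosSemidef) (P Q : Matrix n n ℂ) :
    ‖(M * (P * Qᴴ)).trace‖ ≤
      √(M * (P * Pᴴ)).trace.re * √(M * (Q * Qᴴ)).trace.re := by
  let := M.toMatrixSeminormedAddCommGroup hM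
  let := M.toMatrixInnerProductSpace hM
  have hinner (P Q : Matrix n n ℂ) : inner ℂ Pᴴ Qᴴ = (M * (P * Qᴴ)).trace := by
    change (Qᴴ * M * Pᴴᴴ).trace = _
    rw [conjTranspose_conjTranspose, Matrix.mul_assoc, trace_mul_comm, Matrix.mul_assoc]
  have hnorm (P : Matrix n n ℂ) : ‖Pᴴ‖ = √(M * (P * Pᴴ)).trace.re := by
    rw [norm_eq_sqrt_re_inner (𝕜 := ℂ), hinner]; rfl
  simpa [hinner, hnorm] using norm_inner_le_norm (𝕜 := ℂ) Pᴴ Qᴴ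

lemma norm_trace_mul_kronecker_le {ρ : Matrix (A × B) (A × B) ℂ} (hρ : ρ.PosSemidef)
    (X : Matrix A A ℂ) (Y : Matrix B B ℂ) :
    ‖(ρ * (X ⊗ₖ Yᴴ)).trace‖ ≤
      √(ptrB ρ * (X * Xᴴ)).trace.re * √(ptrA ρ * (Y * Yᴴ)).trace.re := by
  classical
  simpa [trace_ptrB_mul, trace_ptrA_mul, conjTranspose_kronecker, ← mul_kronecker_mul] using
    norm_trace_mul_conjTranspose_le hρ (X ⊗ₖ (1 : Matrix B B ℂ)) ((1 : Matrix A A ℂ) ⊗ₖ Y)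

lemma mu_nonneg (ρ : Matrix (A × B) (A × B) ℂ) : 0 ≤ mu ρ := by
  refine Real.sSup_nonneg ?_
  rintro _ ⟨X, Y, -, -, -, -, rfl⟩
  exact norm_nonneg _

lemma norm_trace_le_mu {ρ : Matrix (A × B) (A × B) ℂ} (hρ : ρ.PosSemidef)
    {X : Matrix A A ℂ} {Y : Matrix B B ℂ}
    (hX : (ptrB ρ * X).trace = 0) (hY : (ptrA ρ * Y).trace = 0)
    (hX1 : (ptrB ρ * (X * Xᴴ)).trace = 1) (hY1 : (ptrA ρ * (Y * Yᴴ)).trace = 1) :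
    ‖(ρ * (X ⊗ₖ Yᴴ)).trace‖ ≤ mu ρ := by
  refine le_csSup ⟨1, ?_⟩ ⟨X, Y, hX, hY, hX1, hY1, rfl⟩
  rintro _ ⟨X, Y, -, -, hX1, hY1, rfl⟩
  simpa [hX1, hY1] using norm_trace_mul_kronecker_le hρ X Y

lemma trace_mul_self_conjTranspose_nonneg {n : Type*} [Fintype n] {M : Matrix n n ℂ}
    (hM : M.PosSemidef) (X : Matrix n n ℂ) : 0 ≤ (M * (X * Xᴴ)).trace := by
  rw [← Matrix.mul_assoc, trace_mul_comm, ← Matrix.mul_assoc]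
  exact (hM.conjTranspose_mul_mul_same X).trace_nonneg

lemma trace_ptrB_mul_self_nonneg {ρ : Matrix (A × B) (A × B) ℂ} (hρ : ρ.PosSemidef)
    (X : Matrix A A ℂ) : 0 ≤ (ptrB ρ * (X * Xᴴ)).trace := by
  classical
  simpa [trace_ptrB_mul, conjTranspose_kronecker, ← mul_kronecker_mul] using
    trace_mul_self_conjTranspose_nonneg hρ (X ⊗ₖ (1 : Matrix B B ℂ))

lemma trace_ptrA_mul_self_nonneg {ρ : Matrix (A × B) (A × B) ℂ} (hρ : ρ.PosSemidef)
    (Y : Matrix B B ℂ) : 0 ≤ (ptrA ρ * (Y * Yᴴ)).trace := by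
  classical
  simpa [trace_ptrA_mul, conjTranspose_kronecker, ← mul_kronecker_mul] using
    trace_mul_self_conjTranspose_nonneg hρ ((1 : Matrix A A ℂ) ⊗ₖ Y)

/-- The homogeneous form of the bound defining the maximal correlation. -/
lemma norm_trace_le_mu_mul {ρ : Matrix (A × B) (A × B) ℂ} (hρ : ρ.PosSemidef)
    {X : Matrix A A ℂ} {Y : Matrix B B ℂ}
    (hX : (ptrB ρ * X).trace = 0) (hY : (ptrA ρ * Y).trace = 0) :
    ‖(ρ * (X ⊗ₖ Yᴴ)).trace‖ ≤
      mu ρ * (√(ptrB ρ * (X * Xᴴ)).trace.re * √(ptrA ρ * (Y * Yᴴ)).trace.re) := by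
  obtain ⟨a, ha0, ha⟩ := RCLike.nonneg_iff_exists_ofReal.1 (trace_ptrB_mul_self_nonneg hρ X)
  obtain ⟨b, hb0, hb⟩ := RCLike.nonneg_iff_exists_ofReal.1 (trace_ptrA_mul_self_nonneg hρ Y)
  have hle := norm_trace_mul_kronecker_le hρ X Y
  rw [← ha, ← hb] at hle ⊢
  simp only [Complex.coe_algebraMap, Complex.ofReal_re] at ha hb hle ⊢
  rcases ha0.eq_or_lt with rfl | ha0
  · simpa using hle
  rcases hb0.eq_or_lt with rfl | hb0
  · simpa using hle
  have hs : 0 < √a := Real.sqrt_pos.2 ha0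
  have ht : 0 < √b := Real.sqrt_pos.2 hb0
  have hsa : ((√a : ℝ) : ℂ) * (√a : ℝ) = a := by
    rw [← Complex.ofReal_mul, Real.mul_self_sqrt ha0.le]
  have htb : ((√b : ℝ) : ℂ) * (√b : ℝ) = b := by
    rw [← Complex.ofReal_mul, Real.mul_self_sqrt hb0.le]
  have ha' : (a : ℂ) ≠ 0 := by exact_mod_cast ha0.ne'
  have hb' : (b : ℂ) ≠ 0 := by exact_mod_cast hb0.ne'
  have h := norm_trace_le_mu hρ (X := ((√a : ℝ) : ℂ)⁻¹ • X) (Y := ((√b : ℝ) : ℂ)⁻¹ • Y)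
    (by simp [hX]) (by simp [hY])
    (by
      rw [conjTranspose_smul, smul_mul_smul_comm, Matrix.mul_smul, trace_smul, ← ha]
      simp [← mul_inv, hsa, ha'])
    (by
      rw [conjTranspose_smul, smul_mul_smul_comm, Matrix.mul_smul, trace_smul, ← hb]
      simp [← mul_inv, htb, hb'])
  have heq : ‖(ρ * ((((√a : ℝ) : ℂ)⁻¹ • X) ⊗ₖ (((√b : ℝ) : ℂ)⁻¹ • Y)ᴴ)).trace‖ =
      ‖(ρ * (X ⊗ₖ Yᴴ)).trace‖ / (√a * √b) := by
    simp [conjTranspose_smul, smul_kronecker, kronecker_smul, abs_of_pos hs, abs_of_pos ht]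
    field_simp
  rwa [heq, div_le_iff₀ (mul_pos hs ht)] at h

lemma trace_ptrB (ρ : Matrix (A × B) (A × B) ℂ) : (ptrB ρ).trace = ρ.trace := by
  simp [trace, ptrB, Fintype.sum_prod_type]

lemma trace_ptrA (ρ : Matrix (A × B) (A × B) ℂ) : (ptrA ρ).trace = ρ.trace := by
  simp only [trace, diag, ptrA, Fintype.sum_prod_type]
  exact Finset.sum_comm

lemma isHermitian_ptrA {A B : Type*} [Fintype A] {ρ : Matrix (A × B) (A × B) ℂ}
    (hρ : ρ.IsHermitian) :
    (ptrA ρ).IsHermitian := by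
  ext k l
  simp only [conjTranspose_apply, ptrA, star_sum]
  exact Finset.sum_congr rfl fun i _ => hρ.apply _ _

/-- Subtract the expectation `tr (M X)` from an observable. -/
def centered {n : Type*} [Fintype n] [DecidableEq n] (M X : Matrix n n ℂ) : Matrix n n ℂ :=
  X - (M * X).trace • (1 : Matrix n n ℂ)

lemma trace_mul_centered {n : Type*} [Fintype n] [DecidableEq n] {M : Matrix n n ℂ}
    (hM : M.trace = 1) (X : Matrix n n ℂ) : (M * centered M X).trace = 0 := by
  simp [centered, Matrix.mul_sub, hM]

lemma centered_eq_self {n : Type*} [Fintype n] [DecidableEq n] {M X : Matrix n n ℂ}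
    (h : (M * X).trace = 0) : centered M X = X := by
  simp [centered, h]

lemma trace_mul_centered_kronecker [DecidableEq A] [DecidableEq B]
    {ρ : Matrix (A × B) (A × B) ℂ} (hρ : IsDensity ρ) (X : Matrix A A ℂ) (Y : Matrix B B ℂ) :
    (ρ * (centered (ptrB ρ) X ⊗ₖ (centered (ptrA ρ) Y)ᴴ)).trace =
      (ρ * (X ⊗ₖ Yᴴ)).trace - (ptrB ρ * X).trace * (ptrA ρ * Yᴴ).trace := by
  have hY : star (ptrA ρ * Y).trace = (ptrA ρ * Yᴴ).trace := by
    rw [← trace_conjTranspose, conjTranspose_mul, (isHermitian_ptrA hρ.1.isHermitian).eq,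
      trace_mul_comm]
  have hcY : (centered (ptrA ρ) Y)ᴴ = Yᴴ + (-(ptrA ρ * Yᴴ).trace) • 1 := by
    rw [centered, conjTranspose_sub, conjTranspose_smul, conjTranspose_one, hY, neg_smul,
      sub_eq_add_neg]
  have hcX : centered (ptrB ρ) X = X + (-(ptrB ρ * X).trace) • 1 := by
    rw [centered, neg_smul, sub_eq_add_neg]
  rw [hcX, hcY]
  simp only [add_kronecker, kronecker_add, smul_kronecker, kronecker_smul, Matrix.mul_add,
    trace_add, Matrix.mul_smul, trace_smul, ← trace_ptrB_mul, ← trace_ptrA_mul, mul_one,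
    trace_ptrB, hρ.2, smul_eq_mul]
  ring

/-- A state of vanishing maximal correlation is a product state. -/
lemma eq_kronecker_of_mu_eq_zero {ρ : Matrix (A × B) (A × B) ℂ} (hρ : IsDensity ρ)
    (h : mu ρ = 0) : ρ = ptrB ρ ⊗ₖ ptrA ρ := by
  classical
  ext ⟨i, k⟩ ⟨j, l⟩
  have hle := norm_trace_le_mu_mul hρ.1
    (trace_mul_centered ((trace_ptrB ρ).trans hρ.2) (single j i 1))
    (trace_mul_centered ((trace_ptrA ρ).trans hρ.2) (single k l 1))
  rw [h, zero_mul, norm_le_zero_iff, trace_mul_centered_kronecker hρ, sub_eq_zero] at hle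
  simpa [conjTranspose_single, single_kronecker_single, trace_mul_single] using hle

/-- Maximal correlation is lower semicontinuous on density matrices. -/
lemma mu_le_of_tendsto_nhds {σ : ℕ → Matrix (A × B) (A × B) ℂ} (hσ : ∀ n, IsDensity (σ n))
    {ρ : Matrix (A × B) (A × B) ℂ} (hconv : Filter.Tendsto σ Filter.atTop (nhds ρ))
    {l : ℝ} (hμ : Filter.Tendsto (fun n => mu (σ n)) Filter.atTop (nhds l)) : mu ρ ≤ l := by
  classical
  refine Real.sSup_le ?_ (ge_of_tendsto' hμ fun n => mu_nonneg (σ n))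
  rintro _ ⟨X, Y, hX, hY, hX1, hY1, rfl⟩
  have hcB : Continuous (ptrB : Matrix (A × B) (A × B) ℂ → Matrix A A ℂ) := by
    unfold ptrB; fun_prop
  have hcA : Continuous (ptrA : Matrix (A × B) (A × B) ℂ → Matrix B B ℂ) := by
    unfold ptrA; fun_prop
  have hcX : Continuous fun τ : Matrix (A × B) (A × B) ℂ => centered (ptrB τ) X := by
    unfold centered; fun_prop
  have hcY : Continuous fun τ : Matrix (A × B) (A × B) ℂ => centered (ptrA τ) Y := by
    unfold centered; fun_prop
  have hcK : Continuous fun τ : Matrix (A × B) (A × B) ℂ =>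
      centered (ptrB τ) X ⊗ₖ (centered (ptrA τ) Y)ᴴ :=
    continuous_matrix fun i j => (hcX.matrix_elem i.1 j.1).mul
      (hcY.matrix_conjTranspose.matrix_elem i.2 j.2)
  have hlhs : Continuous fun τ : Matrix (A × B) (A × B) ℂ =>
      ‖(τ * (centered (ptrB τ) X ⊗ₖ (centered (ptrA τ) Y)ᴴ)).trace‖ := by fun_prop
  have hrhs : Continuous fun τ : Matrix (A × B) (A × B) ℂ =>
      √(ptrB τ * (centered (ptrB τ) X * (centered (ptrB τ) X)ᴴ)).trace.re *
        √(ptrA τ * (centered (ptrA τ) Y * (centered (ptrA τ) Y)ᴴ)).trace.re := by fun_prop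
  have h := le_of_tendsto_of_tendsto' ((hlhs.tendsto ρ).comp hconv)
    (hμ.mul ((hrhs.tendsto ρ).comp hconv)) fun n =>
      norm_trace_le_mu_mul (hσ n).1
        (trace_mul_centered ((trace_ptrB (σ n)).trans (hσ n).2) X)
        (trace_mul_centered ((trace_ptrA (σ n)).trans (hσ n).2) Y)
  simpa [centered_eq_self hX, centered_eq_self hY, hX1, hY1] using h

end MaximalCorrelation

/-- Lower semicontinuity of maximal correlation along entrywise convergent sequences. -/
theorem mu_le_of_tendsto {dA dB : ℕ}
    (σ : ℕ → Matrix (Fin dA × Fin dB) (Fin dA × Fin dB) ℂ)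
    (hσ : ∀ n, IsDensity (σ n))
    (ρ : Matrix (Fin dA × Fin dB) (Fin dA × Fin dB) ℂ) (hρ : IsDensity ρ)
    (hconv : ∀ x y, Filter.Tendsto (fun n => σ n x y) Filter.atTop (nhds (ρ x y)))
    (l : ℝ) (hμ : Filter.Tendsto (fun n => mu (σ n)) Filter.atTop (nhds l)) :
    mu ρ ≤ l ∧ (l = 0 → ρ = ptrB ρ ⊗ₖ ptrA ρ) := by
  have hle : mu ρ ≤ l :=
    mu_le_of_tendsto_nhds hσ (tendsto_pi_nhds.2 fun x => tendsto_pi_nhds.2 (hconv x)) hμ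
  exact ⟨hle, fun hl => eq_kronecker_of_mu_eq_zero hρ ((hle.trans hl.le).antisymm (mu_nonneg ρ))⟩
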